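/- Let α > 0, let p_1, p_2 > 0 with p_1 + p_2 = 1, let μ_1, μ_2 be probability measures on ℝ^d with finite α-th moments, and let μ := p_1 μ_1 + p_2 μ_2. Then (a) p_1 T(μ_1,μ;α) + p_2 T(μ_2,μ;α) = p_1 p_2 T(μ_1,μ_2;α), and (b) p_1² T(μ_1,μ;α) + p_2² T(μ_2,μ;α) = 2 p_1² p_2² T(μ_1,μ_2;α); consequently the Gini distance covariance gCov(α) = p_1 T(μ_1,μ;α) + p_2 T(μ_2,μ;α) equals (1/(2 p_1 p_2)) · (p_1² T(μ_1,μ;α) + p_2² T(μ_2,μ;α)), i.e., for K = 2 classes gCov(X,Y;α) = dCov(X,Y;α)/(2 p_1 p_2). -/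

import Mathlib

open MeasureTheory ProbabilityTheory
open scoped ENNReal BigOperators

/-- The generalized Gini mean difference `Δ(μ,ν;α) = ∫∫ ‖x − y‖^α dμ(x) dν(y)`. -/
noncomputable def giniDelta {E : Type*} [NormedAddCommGroup E] [MeasurableSpace E]
    (α : ℝ) (μ ν : Measure E) : ℝ := ∫ x, ∫ y, ‖x - y‖ ^ α ∂ν ∂μ

/-- The energy distance `T(μ,ν;α) = 2Δ(μ,ν;α) − Δ(μ;α) − Δ(ν;α)`. -/
noncomputable def energyDist {E : Type*} [NormedAddCommGroup E] [MeasurableSpace E]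
    (α : ℝ) (μ ν : Measure E) : ℝ :=
  2 * giniDelta α μ ν - giniDelta α μ μ - giniDelta α ν ν

theorem gini_integrable_prod {d : ℕ} {α : ℝ} (hα : 0 < α)
    (μ ν : Measure (EuclideanSpace ℝ (Fin d)))
    [IsProbabilityMeasure μ] [IsProbabilityMeasure ν]
    (hμ : Integrable (fun x => ‖x‖ ^ α) μ) (hν : Integrable (fun x => ‖x‖ ^ α) ν) :
    Integrable (fun z : EuclideanSpace ℝ (Fin d) × EuclideanSpace ℝ (Fin d) =>
      ‖z.1 - z.2‖ ^ α) (μ.prod ν) := by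
  have h := ((hμ.comp_fst ν).add (hν.comp_snd μ)).const_mul ((2 : ℝ) ^ α)
  refine h.mono' ?_ ?_
  · exact ((continuous_fst.sub continuous_snd).norm.rpow_const
      (fun _ => Or.inr hα.le)).aestronglyMeasurable
  · refine Filter.Eventually.of_forall fun z => ?_
    obtain ⟨x, y⟩ := z
    have h0 : 0 ≤ ‖x - y‖ ^ α := by positivity
    simp only [Pi.add_apply, Real.norm_eq_abs, abs_of_nonneg h0]
    have hx : 0 ≤ ‖x‖ ^ α := by positivity
    have hy : 0 ≤ ‖y‖ ^ α := by positivity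
    have h2 : (0 : ℝ) ≤ 2 ^ α := by positivity
    have hsub := norm_sub_le x y
    rcases le_total ‖x‖ ‖y‖ with hxy | hxy
    · calc ‖x - y‖ ^ α ≤ (2 * ‖y‖) ^ α :=
            Real.rpow_le_rpow (norm_nonneg _) (by linarith) hα.le
        _ = 2 ^ α * ‖y‖ ^ α := Real.mul_rpow (by norm_num) (norm_nonneg _)
        _ ≤ _ := mul_le_mul_of_nonneg_left (by linarith) h2
    · calc ‖x - y‖ ^ α ≤ (2 * ‖x‖) ^ α :=
            Real.rpow_le_rpow (norm_nonneg _) (by linarith) hα.le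
        _ = 2 ^ α * ‖x‖ ^ α := Real.mul_rpow (by norm_num) (norm_nonneg _)
        _ ≤ _ := mul_le_mul_of_nonneg_left (by linarith) h2

theorem gini_integrable_section {d : ℕ} {α : ℝ} (hα : 0 < α)
    (ν : Measure (EuclideanSpace ℝ (Fin d))) [IsProbabilityMeasure ν]
    (hν : Integrable (fun x => ‖x‖ ^ α) ν) (x : EuclideanSpace ℝ (Fin d)) :
    Integrable (fun y => ‖x - y‖ ^ α) ν := by
  have hd : Integrable (fun x => ‖x‖ ^ α) (Measure.dirac x) := integrable_dirac (by simp)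
  have h := (gini_integrable_prod hα (Measure.dirac x) ν hd hν)
  rw [Measure.dirac_prod] at h
  exact h.comp_measurable measurable_prodMk_left

theorem gini_comm {d : ℕ} {α : ℝ} (hα : 0 < α)
    (μ ν : Measure (EuclideanSpace ℝ (Fin d)))
    [IsProbabilityMeasure μ] [IsProbabilityMeasure ν]
    (hμ : Integrable (fun x => ‖x‖ ^ α) μ) (hν : Integrable (fun x => ‖x‖ ^ α) ν) :
    giniDelta α μ ν = giniDelta α ν μ := by
  unfold giniDelta
  rw [integral_integral_swap (gini_integrable_prod hα μ ν hμ hν)]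
  simp only [norm_sub_rev]

theorem gini_mix_right {d : ℕ} {α : ℝ} (hα : 0 < α) {p q : ℝ} (hp : 0 < p) (hq : 0 < q)
    (μ ν ρ : Measure (EuclideanSpace ℝ (Fin d)))
    [IsProbabilityMeasure μ] [IsProbabilityMeasure ν] [IsProbabilityMeasure ρ]
    (hμ : Integrable (fun x => ‖x‖ ^ α) μ) (hν : Integrable (fun x => ‖x‖ ^ α) ν)
    (hρ : Integrable (fun x => ‖x‖ ^ α) ρ) :
    giniDelta α μ (ENNReal.ofReal p • ν + ENNReal.ofReal q • ρ)
      = p * giniDelta α μ ν + q * giniDelta α μ ρ := by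
  unfold giniDelta
  have h : ∀ x : EuclideanSpace ℝ (Fin d),
      ∫ y, ‖x - y‖ ^ α ∂(ENNReal.ofReal p • ν + ENNReal.ofReal q • ρ)
        = p * ∫ y, ‖x - y‖ ^ α ∂ν + q * ∫ y, ‖x - y‖ ^ α ∂ρ := by
    intro x
    rw [integral_add_measure
      ((gini_integrable_section hα ν hν x).smul_measure ENNReal.ofReal_ne_top)
      ((gini_integrable_section hα ρ hρ x).smul_measure ENNReal.ofReal_ne_top),
      integral_smul_measure, integral_smul_measure, ENNReal.toReal_ofReal hp.le,
      ENNReal.toReal_ofReal hq.le, smul_eq_mul, smul_eq_mul]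
  simp_rw [h]
  have i1 := (gini_integrable_prod hα μ ν hμ hν).integral_prod_left
  have i2 := (gini_integrable_prod hα μ ρ hμ hρ).integral_prod_left
  rw [integral_add (i1.const_mul p) (i2.const_mul q), integral_const_mul, integral_const_mul]

theorem gini_mix_left {d : ℕ} {α : ℝ} {p q : ℝ} (hp : 0 < p) (hq : 0 < q)
    (hα : 0 < α) (μ ν : Measure (EuclideanSpace ℝ (Fin d)))
    [IsProbabilityMeasure μ] [IsProbabilityMeasure ν] (hpq : p + q = 1)
    (hμ : Integrable (fun x => ‖x‖ ^ α) μ) (hν : Integrable (fun x => ‖x‖ ^ α) ν) :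
    giniDelta α (ENNReal.ofReal p • μ + ENNReal.ofReal q • ν)
        (ENNReal.ofReal p • μ + ENNReal.ofReal q • ν)
      = p * giniDelta α μ (ENNReal.ofReal p • μ + ENNReal.ofReal q • ν)
        + q * giniDelta α ν (ENNReal.ofReal p • μ + ENNReal.ofReal q • ν) := by
  have : IsProbabilityMeasure (ENNReal.ofReal p • μ + ENNReal.ofReal q • ν) := by
    constructor
    simp [← ENNReal.ofReal_add hp.le hq.le, hpq]
  have hm : Integrable (fun x => ‖x‖ ^ α) (ENNReal.ofReal p • μ + ENNReal.ofReal q • ν) :=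
    (hμ.smul_measure ENNReal.ofReal_ne_top).add_measure
      (hν.smul_measure ENNReal.ofReal_ne_top)
  rw [gini_mix_right hα hp hq _ μ ν hm hμ hν, gini_comm hα _ μ hm hμ, gini_comm hα _ ν hm hν]

/-- For a two-component mixture `μ = p₁μ₁ + p₂μ₂`:
(a) `p₁T(μ₁,μ;α) + p₂T(μ₂,μ;α) = p₁p₂T(μ₁,μ₂;α)`;
(b) `p₁²T(μ₁,μ;α) + p₂²T(μ₂,μ;α) = 2p₁²p₂²T(μ₁,μ₂;α)`;
consequently `gCov(X,Y;α) = dCov(X,Y;α)/(2p₁p₂)`. -/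
theorem two_class_gcov_dcov_relation
    (d : ℕ) (α : ℝ) (hα : 0 < α)
    (p₁ p₂ : ℝ) (hp₁ : 0 < p₁) (hp₂ : 0 < p₂) (hsum : p₁ + p₂ = 1)
    (μ₁ μ₂ : Measure (EuclideanSpace ℝ (Fin d)))
    [IsProbabilityMeasure μ₁] [IsProbabilityMeasure μ₂]
    (hmom₁ : Integrable (fun x => ‖x‖ ^ α) μ₁) (hmom₂ : Integrable (fun x => ‖x‖ ^ α) μ₂) :
    p₁ * energyDist α μ₁ (ENNReal.ofReal p₁ • μ₁ + ENNReal.ofReal p₂ • μ₂)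
        + p₂ * energyDist α μ₂ (ENNReal.ofReal p₁ • μ₁ + ENNReal.ofReal p₂ • μ₂)
      = p₁ * p₂ * energyDist α μ₁ μ₂ ∧
    p₁ ^ 2 * energyDist α μ₁ (ENNReal.ofReal p₁ • μ₁ + ENNReal.ofReal p₂ • μ₂)
        + p₂ ^ 2 * energyDist α μ₂ (ENNReal.ofReal p₁ • μ₁ + ENNReal.ofReal p₂ • μ₂)
      = 2 * p₁ ^ 2 * p₂ ^ 2 * energyDist α μ₁ μ₂ ∧
    p₁ * energyDist α μ₁ (ENNReal.ofReal p₁ • μ₁ + ENNReal.ofReal p₂ • μ₂)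
        + p₂ * energyDist α μ₂ (ENNReal.ofReal p₁ • μ₁ + ENNReal.ofReal p₂ • μ₂)
      = (1 / (2 * p₁ * p₂))
          * (p₁ ^ 2 * energyDist α μ₁ (ENNReal.ofReal p₁ • μ₁ + ENNReal.ofReal p₂ • μ₂)
            + p₂ ^ 2 * energyDist α μ₂ (ENNReal.ofReal p₁ • μ₁ + ENNReal.ofReal p₂ • μ₂)) := by
  have c := gini_comm hα μ₂ μ₁ hmom₂ hmom₁
  have e1 : energyDist α μ₁ (ENNReal.ofReal p₁ • μ₁ + ENNReal.ofReal p₂ • μ₂)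
      = p₂ ^ 2 * energyDist α μ₁ μ₂ := by
    unfold energyDist
    rw [gini_mix_left hp₁ hp₂ hα μ₁ μ₂ hsum hmom₁ hmom₂,
      gini_mix_right hα hp₁ hp₂ μ₁ μ₁ μ₂ hmom₁ hmom₁ hmom₂,
      gini_mix_right hα hp₁ hp₂ μ₂ μ₁ μ₂ hmom₂ hmom₁ hmom₂, c]
    obtain rfl : p₁ = 1 - p₂ := by linarith
    ring
  have e2 : energyDist α μ₂ (ENNReal.ofReal p₁ • μ₁ + ENNReal.ofReal p₂ • μ₂)
      = p₁ ^ 2 * energyDist α μ₁ μ₂ := by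
    unfold energyDist
    rw [gini_mix_left hp₁ hp₂ hα μ₁ μ₂ hsum hmom₁ hmom₂,
      gini_mix_right hα hp₁ hp₂ μ₁ μ₁ μ₂ hmom₁ hmom₁ hmom₂,
      gini_mix_right hα hp₁ hp₂ μ₂ μ₁ μ₂ hmom₂ hmom₁ hmom₂, c]
    obtain rfl : p₁ = 1 - p₂ := by linarith
    ring
  have a : p₁ * (p₂ ^ 2 * energyDist α μ₁ μ₂) + p₂ * (p₁ ^ 2 * energyDist α μ₁ μ₂)
      = p₁ * p₂ * energyDist α μ₁ μ₂ := by
    linear_combination p₁ * p₂ * energyDist α μ₁ μ₂ * hsum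
  rw [e1, e2]
  refine ⟨a, by ring, ?_⟩
  rw [a]
  field_simp
  ring
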